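/- Characterization of non-special divisors: Let G be a graph of genus g and let D ∈ Div(G) with deg(D) = g − 1. Then D is not linearly equivalent to any effective divisor if and only if there exists a linear (total) order <_P on V(G) such that D ∼ ν_P. -/

import Mathlib

open Finset

variable {V : Type}

/-- Degree of a vertex in the multigraph with edge multiplicities `m`. -/
def mdeg [Fintype V] (m : V → V → ℕ) (v : V) : ℕ := ∑ w, m v w

/-- The Laplacian of an integer-valued function on the vertices. -/
def laplacian [Fintype V] (m : V → V → ℕ) (f : V → ℤ) : V → ℤ :=
  fun v => (mdeg m v : ℤ) * f v - ∑ w, (m v w : ℤ) * f w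

/-- Linear equivalence of divisors. -/
def LinEquiv [Fintype V] (m : V → V → ℕ) (D D' : V → ℤ) : Prop :=
  ∃ f : V → ℤ, D - D' = laplacian m f

/-- A divisor is effective if it is nonnegative everywhere. -/
def Effective (D : V → ℤ) : Prop := ∀ v, 0 ≤ D v

/-- Degree of a divisor. -/
def divDeg [Fintype V] (D : V → ℤ) : ℤ := ∑ v, D v

/-- `D` is linearly equivalent to some effective divisor. -/
def Winnable [Fintype V] (m : V → V → ℕ) (D : V → ℤ) : Prop :=
  ∃ E, Effective E ∧ LinEquiv m D E

/-- Number of edges of the multigraph. -/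
def edgeCount [Fintype V] (m : V → V → ℕ) : ℤ := (∑ v, ∑ w, (m v w : ℤ)) / 2

/-- The genus `g = |E| - |V| + 1`. -/
def genus [Fintype V] (m : V → V → ℕ) : ℤ := edgeCount m - Fintype.card V + 1

/-- `m` describes a graph: symmetric, loopless, and connected. -/
def IsGraph [Fintype V] (m : V → V → ℕ) : Prop :=
  (∀ v w, m v w = m w v) ∧ (∀ v, m v v = 0) ∧
  (SimpleGraph.fromRel (fun v w => 0 < m v w)).Connected


open Classical in
/-- The divisor `ν_P` associated to a (strict) linear order `r` on the vertices:
`ν_P(v) = (number of edges from `v` to vertices preceding `v`) - 1`. -/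
noncomputable def nuP [Fintype V] (m : V → V → ℕ) (r : V → V → Prop) : V → ℤ :=
  fun v => (∑ w, if r w v then (m v w : ℤ) else 0) - 1

lemma lap_eq [Fintype V] (m : V → V → ℕ) (f : V → ℤ) (v : V) :
    laplacian m f v = ∑ w, (m v w : ℤ) * (f v - f w) := by
  simp only [laplacian, mdeg, mul_sub, Finset.sum_sub_distrib, Nat.cast_sum, Finset.sum_mul]

lemma lap_add [Fintype V] (m : V → V → ℕ) (f g : V → ℤ) :
    laplacian m (f + g) = laplacian m f + laplacian m g := by
  funext v
  simp only [Pi.add_apply, lap_eq, ← Finset.sum_add_distrib]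
  exact Finset.sum_congr rfl fun w _ => by ring

lemma lap_sub [Fintype V] (m : V → V → ℕ) (f g : V → ℤ) :
    laplacian m (f - g) = laplacian m f - laplacian m g := by
  funext v
  simp only [Pi.sub_apply, lap_eq, ← Finset.sum_sub_distrib]
  exact Finset.sum_congr rfl fun w _ => by ring

lemma lap_zero [Fintype V] (m : V → V → ℕ) : laplacian m 0 = 0 := by
  funext v
  simp [lap_eq]

lemma sum_lap [Fintype V] (m : V → V → ℕ) (hs : ∀ v w, m v w = m w v) (f : V → ℤ) :
    ∑ v, laplacian m f v = 0 := by
  simp only [lap_eq]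
  have h : ∑ v, ∑ w, (m v w : ℤ) * (f v - f w) = - ∑ v, ∑ w, (m v w : ℤ) * (f v - f w) := by
    conv_lhs => rw [Finset.sum_comm]
    simp only [← Finset.sum_neg_distrib]
    refine Finset.sum_congr rfl fun v _ => Finset.sum_congr rfl fun w _ => ?_
    rw [hs w v]; ring
  omega

lemma lin_symm [Fintype V] {m : V → V → ℕ} {D E : V → ℤ} (h : LinEquiv m D E) :
    LinEquiv m E D := by
  obtain ⟨f, hf⟩ := h
  refine ⟨0 - f, ?_⟩
  rw [lap_sub, lap_zero, ← hf]; abel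

lemma lin_trans [Fintype V] {m : V → V → ℕ} {D E F : V → ℤ} (h : LinEquiv m D E)
    (h' : LinEquiv m E F) : LinEquiv m D F := by
  obtain ⟨f, hf⟩ := h
  obtain ⟨g, hg⟩ := h'
  refine ⟨f + g, ?_⟩
  rw [lap_add, ← hf, ← hg]; abel

lemma lin_deg [Fintype V] {m : V → V → ℕ} (hs : ∀ v w, m v w = m w v) {D E : V → ℤ}
    (h : LinEquiv m D E) : ∑ v, D v = ∑ v, E v := by
  obtain ⟨f, hf⟩ := h
  have := sum_lap m hs f
  rw [← hf] at this
  simp only [Pi.sub_apply, Finset.sum_sub_distrib] at this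
  omega

lemma lap_ker [Fintype V] (m : V → V → ℕ) (hm : IsGraph m) (f : V → ℤ)
    (hf : laplacian m f = 0) (a b : V) : f a = f b := by
  obtain ⟨hs, -, hc⟩ := hm
  obtain ⟨M, -, hM⟩ := Finset.exists_max_image Finset.univ f ⟨a, Finset.mem_univ a⟩
  have key : ∀ v w, f v = f M → 0 < m v w → f w = f M := by
    intro v w hv hw
    have h0 := congrFun hf v
    rw [lap_eq, Pi.zero_apply, Finset.sum_eq_zero_iff_of_nonneg] at h0
    · have := h0 w (Finset.mem_univ w)
      rcases mul_eq_zero.mp this with h | h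
      · omega
      · omega
    · intro u _
      have := hM u (Finset.mem_univ u)
      exact mul_nonneg (by positivity) (by omega)
  have all : ∀ c, f c = f M := by
    intro c
    obtain ⟨p⟩ := hc.preconnected c M
    induction p with
    | nil => rfl
    | cons hadj p ih =>
      have ih' := ih hM key
      rw [SimpleGraph.fromRel_adj] at hadj
      refine (key _ _ ih' ?_)
      rcases hadj.2 with h | h
      · rw [hs]; exact h
      · exact h
  rw [all a, all b]

open Classical in
lemma nuP_deg [Fintype V] (m : V → V → ℕ) (hm : IsGraph m) (r : V → V → Prop)
    (hr : IsStrictTotalOrder V r) : ∑ v, nuP m r v = genus m - 1 := by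
  obtain ⟨hs, hl, -⟩ := hm
  have h1 : ∑ v, ∑ w, (if r w v then (m v w : ℤ) else 0)
      = ∑ v, ∑ w, (if r v w then (m v w : ℤ) else 0) := by
    conv_lhs => rw [Finset.sum_comm]
    refine Finset.sum_congr rfl fun v _ => Finset.sum_congr rfl fun w _ => ?_
    rw [hs w v]
  have h2 : ∑ v, ∑ w, (m v w : ℤ) = ∑ v, ∑ w, (if r w v then (m v w : ℤ) else 0)
      + ∑ v, ∑ w, (if r v w then (m v w : ℤ) else 0) := by
    simp only [← Finset.sum_add_distrib]
    refine Finset.sum_congr rfl fun v _ => Finset.sum_congr rfl fun w _ => ?_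
    rcases trichotomous_of r v w with h | h | h
    · have : ¬ r w v := fun h' => asymm_of r h h'
      simp [h, this]
    · subst h
      simp [hl]
    · have : ¬ r v w := fun h' => asymm_of r h h'
      simp [h, this]
  simp only [nuP, genus, edgeCount, Finset.sum_sub_distrib, Finset.sum_const, Finset.card_univ]
  simp only [nsmul_eq_mul, mul_one]
  omega

open Classical in
lemma nuP_not_win [Fintype V] (m : V → V → ℕ) (hm : IsGraph m) (r : V → V → Prop)
    (hr : IsStrictTotalOrder V r) : ¬ Winnable m (nuP m r) := by
  rintro ⟨E, hE, f, hf⟩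
  obtain ⟨a⟩ := hm.2.2.nonempty
  obtain ⟨M, -, hM⟩ := Finset.exists_max_image Finset.univ f ⟨a, Finset.mem_univ a⟩
  have wf : WellFounded r := Finite.wellFounded_of_trans_of_irrefl r
  obtain ⟨v, hv, hmin⟩ := wf.has_min {x | f x = f M} ⟨M, rfl⟩
  have h := congrFun hf v
  rw [lap_eq, Pi.sub_apply, nuP] at h
  have hle : ∑ w, (if r w v then (m v w : ℤ) else 0) ≤ ∑ w, (m v w : ℤ) * (f v - f w) := by
    refine Finset.sum_le_sum fun w _ => ?_
    have h1 := hM w (Finset.mem_univ w)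
    have hv' : f v = f M := hv
    split_ifs with hw
    · have : f w ≠ f M := fun h' => hmin w h' hw
      have : 1 ≤ f v - f w := by omega
      nlinarith [Int.natCast_nonneg (m v w)]
    · exact mul_nonneg (by positivity) (by omega)
  have := hE v
  omega

open Classical in
lemma burn [Fintype V] (m : V → V → ℕ) (D : V → ℤ)
    (H : ∀ B : Finset V, B ≠ Finset.univ → ∃ v, v ∉ B ∧ D v + 1 ≤ ∑ w ∈ B, (m v w : ℤ)) :
    ∃ r : V → V → Prop, IsStrictTotalOrder V r ∧ ∀ v, D v ≤ nuP m r v := by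
  have key : ∀ n ≤ Fintype.card V, ∃ B : Finset V, B.card = n ∧ ∃ ρ : V → ℕ,
      Set.InjOn ρ B ∧ (∀ v ∈ B, ρ v < n) ∧
      ∀ v ∈ B, D v + 1 ≤ ∑ w ∈ B, if ρ w < ρ v then (m v w : ℤ) else 0 := by
    intro n
    induction n with
    | zero => intro _; exact ⟨∅, by simp, fun _ => 0, by simp, by simp, by simp⟩
    | succ n ih =>
      intro hn
      obtain ⟨B, hB, ρ, hinj, hlt, hD⟩ := ih (by omega)
      obtain ⟨v, hv, hvD⟩ := H B (by
        rintro rfl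
        rw [Finset.card_univ] at hB
        omega)
      have hne : ∀ w ∈ B, w ≠ v := fun w hw h => hv (h ▸ hw)
      refine ⟨insert v B, by rw [Finset.card_insert_of_notMem hv, hB],
        Function.update ρ v n, ?_, ?_, ?_⟩
      · intro x hx y hy hxy
        simp only [Finset.coe_insert, Set.mem_insert_iff, Finset.mem_coe] at hx hy
        rcases hx with rfl | hx <;> rcases hy with rfl | hy
        · rfl
        · rw [Function.update_self, Function.update_of_ne (hne y hy)] at hxy
          have := hlt y hy; omega
        · rw [Function.update_self, Function.update_of_ne (hne x hx)] at hxy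
          have := hlt x hx; omega
        · rw [Function.update_of_ne (hne y hy), Function.update_of_ne (hne x hx)] at hxy
          exact hinj hx hy hxy
      · intro x hx
        rcases Finset.mem_insert.mp hx with rfl | hx
        · simp
        · rw [Function.update_of_ne (hne x hx)]
          have := hlt x hx; omega
      · intro x hx
        rw [Finset.sum_insert hv]
        rcases Finset.mem_insert.mp hx with rfl | hx
        · simp only [Function.update_self, lt_irrefl, if_false, zero_add]
          refine hvD.trans (le_of_eq (Finset.sum_congr rfl fun w hw => ?_))
          rw [Function.update_of_ne (hne w hw), if_pos (hlt w hw)]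
        · rw [Function.update_of_ne (hne x hx), Function.update_self]
          have hx' := hlt x hx
          rw [if_neg (by omega), zero_add]
          refine (hD x hx).trans (le_of_eq (Finset.sum_congr rfl fun w hw => ?_))
          rw [Function.update_of_ne (hne w hw)]
  obtain ⟨B, hB, ρ, hinj, -, hD⟩ := key _ le_rfl
  have hBu : B = Finset.univ := (Finset.card_eq_iff_eq_univ B).mp hB
  subst hBu
  have hinj' : Function.Injective ρ := fun x y h => hinj (by simp) (by simp) h
  refine ⟨fun x y => ρ x < ρ y, ?_, ?_⟩
  · exact
    { trichotomous := fun a b h1 h2 => hinj' (by omega)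
      irrefl := fun a => lt_irrefl _
      trans := fun a b c => lt_trans }
  · intro v
    have := hD v (Finset.mem_univ v)
    have h2 : nuP m (fun x y => ρ x < ρ y) v
        = (∑ w, if ρ w < ρ v then (m v w : ℤ) else 0) - 1 := by
      unfold nuP
      congr!
    omega

open Classical in
lemma exists_red [Fintype V] (m : V → V → ℕ) (hm : IsGraph m) (D : V → ℤ)
    (hD : ¬ Winnable m D) : ∃ D', LinEquiv m D D' ∧
    ∀ B : Finset V, B ≠ Finset.univ → ∃ v, v ∉ B ∧ D' v + 1 ≤ ∑ w ∈ B, (m v w : ℤ) := by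
  have hs := hm.1
  let N : (V → ℤ) → Finset V := fun E => Finset.univ.filter fun v => E v < 0
  obtain ⟨D0, hD0, hmin⟩ : ∃ D0, LinEquiv m D D0 ∧
      ∀ E, LinEquiv m D E → (N D0).card ≤ (N E).card := by
    have hne : {E | LinEquiv m D E}.Nonempty := ⟨D, 0, by rw [lap_zero, sub_self]⟩
    refine ⟨Function.argminOn (fun E => (N E).card) _ hne, Function.argminOn_mem _ _ hne, ?_⟩
    intro E hE
    exact Function.argminOn_le (fun E => (N E).card) {E | LinEquiv m D E} hE
  have hq : ∃ q, D0 q < 0 := by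
    by_contra! h
    exact hD ⟨D0, h, hD0⟩
  obtain ⟨q, hq⟩ := hq
  let F : Set (V → ℤ) := {f | f q = 0 ∧ ∀ v, min (D0 v) 0 ≤ (D0 - laplacian m f) v}
  have hFin : F.Finite := by
    let c : V → ℤ := fun v => min (D0 v) 0
    let u : V → ℤ := fun v => ∑ v, D0 v - ∑ w ∈ Finset.univ.erase v, c w
    refine Set.Finite.of_finite_image (f := fun f => D0 - laplacian m f) ?_ ?_
    · refine (Set.finite_Icc c u).subset ?_
      rintro _ ⟨f, ⟨-, hf⟩, rfl⟩
      refine ⟨hf, fun v => ?_⟩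
      have hsum : ∑ v, (D0 - laplacian m f) v = ∑ v, D0 v := by
        simp only [Pi.sub_apply, Finset.sum_sub_distrib, sum_lap m hs f, sub_zero]
      rw [← Finset.add_sum_erase _ _ (Finset.mem_univ v)] at hsum
      have hle : ∑ w ∈ Finset.univ.erase v, c w
          ≤ ∑ w ∈ Finset.univ.erase v, (D0 - laplacian m f) w :=
        Finset.sum_le_sum fun w _ => hf w
      simp only [u]
      omega
    · intro f hf g hg hfg
      have h0 : laplacian m (f - g) = 0 := by
        rw [lap_sub]
        have : D0 - laplacian m f = D0 - laplacian m g := hfg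
        rw [sub_right_inj] at this
        rw [this, sub_self]
      funext v
      have := lap_ker m hm _ h0 v q
      simp only [Pi.sub_apply, hf.1, hg.1] at this
      omega
  have hF0 : (0 : V → ℤ) ∈ F := by
    refine ⟨rfl, fun v => ?_⟩
    rw [lap_zero, sub_zero]
    exact min_le_left _ _
  obtain ⟨f, hf, hfmax⟩ := Set.exists_max_image F (fun f => ∑ v, f v) hFin ⟨0, hF0⟩
  have heq : LinEquiv m D (D0 - laplacian m f) := lin_trans hD0 ⟨f, by abel⟩
  refine ⟨D0 - laplacian m f, heq, ?_⟩
  have hsub : N (D0 - laplacian m f) ⊆ N D0 := by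
    intro v hv
    have h1 := hf.2 v
    simp only [N, Finset.mem_filter, Finset.mem_univ, true_and] at hv ⊢
    by_contra h
    rw [min_eq_right (by omega)] at h1
    omega
  have hN : N (D0 - laplacian m f) = N D0 := Finset.eq_of_subset_of_card_le hsub (hmin _ heq)
  have hq1 : (D0 - laplacian m f) q < 0 := by
    have : q ∈ N (D0 - laplacian m f) := by rw [hN]; simpa [N] using hq
    simpa [N] using this
  intro B hB
  by_contra! hcon
  have hqB : q ∈ B := by
    by_contra h
    have := hcon q h
    have h2 : (0 : ℤ) ≤ ∑ w ∈ B, (m q w : ℤ) := Finset.sum_nonneg fun w _ => by positivity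
    omega
  let χ : V → ℤ := fun v => if v ∈ B then 0 else 1
  have hmem : f + χ ∈ F := by
    refine ⟨by simp [χ, hqB, hf.1], fun v => ?_⟩
    rw [lap_add]
    have h1 := hf.2 v
    simp only [Pi.sub_apply, Pi.add_apply] at h1 hcon ⊢
    by_cases hv : v ∈ B
    · have : laplacian m χ v ≤ 0 := by
        rw [lap_eq]
        refine Finset.sum_nonpos fun w _ => ?_
        simp only [χ, hv, if_true]
        split_ifs <;> simp
      omega
    · have : laplacian m χ v = ∑ w ∈ B, (m v w : ℤ) := by
        rw [lap_eq, ← Finset.sum_subset (Finset.subset_univ B)]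
        · refine Finset.sum_congr rfl fun w hw => ?_
          simp [χ, hv, hw]
        · intro w _ hw
          simp [χ, hv, hw]
      have h2 := hcon v hv
      have := min_le_right (D0 v) 0
      omega
  have hlt := hfmax _ hmem
  have hpos : 0 < ∑ v, χ v := by
    obtain ⟨x, hx⟩ : ∃ x, x ∉ B := by
      by_contra! h
      exact hB (Finset.eq_univ_iff_forall.mpr h)
    refine Finset.sum_pos' (fun v _ => ?_) ⟨x, Finset.mem_univ x, by simp [χ, hx]⟩
    simp only [χ]; split_ifs <;> simp
  simp only [Pi.add_apply, Finset.sum_add_distrib] at hlt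
  omega

theorem nonspecial_iff_nuP [Fintype V] (m : V → V → ℕ) (hm : IsGraph m)
    (D : V → ℤ) (hdeg : divDeg D = genus m - 1) :
    ¬ Winnable m D ↔
      ∃ r : V → V → Prop, IsStrictTotalOrder V r ∧ LinEquiv m D (nuP m r) := by
  constructor
  · intro h
    obtain ⟨D', hD', hB⟩ := exists_red m hm D h
    obtain ⟨r, hr, hle⟩ := burn m D' hB
    refine ⟨r, hr, ?_⟩
    have h1 := nuP_deg m hm r hr
    have h2 := lin_deg hm.1 hD'
    have h3 : ∑ v, D' v = ∑ v, nuP m r v := by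
      rw [h1, ← h2]; exact hdeg
    have h4 := (Finset.sum_eq_sum_iff_of_le (fun v _ => hle v)).mp h3
    have h5 : D' = nuP m r := funext fun v => h4 v (Finset.mem_univ v)
    rw [← h5]; exact hD'
  · rintro ⟨r, hr, h⟩ ⟨E, hE, hDE⟩
    exact nuP_not_win m hm r hr ⟨E, hE, lin_trans (lin_symm h) hDE⟩
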